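/- Let J be the linear endomorphism of T*𝔥₃ with Je₁ = e₂, Je₂ = −e₁, Je₃ = −e₆, Je₆ = e₃, Je₄ = e₅, Je₅ = −e₄, and for reals a₁₂, a₁₃, a₁₄, a₁₅, a₁₆ with a₁₄ ≠ 0 let Ω be the 2-form Ω = a₁₂ e¹∧e² + a₁₃(e¹∧e³ − e²∧e⁶) + a₁₄(e¹∧e⁴ + e²∧e⁵ − 2e³∧e⁶) + a₁₅(e¹∧e⁵ − e²∧e⁴) + a₁₆(e¹∧e⁶ + e²∧e³), where (e¹,…,e⁶) is the dual basis. Define ⟨x,y⟩ = Ω(Jx, y). Then: ⟨·,·⟩ is a nondegenerate symmetric bilinear form; J² = −id and the Nijenhuis tensor N_J(x,y) = [x,y] − [Jx,Jy] + J[Jx,y] + J[x,Jy] vanishes; ⟨Jx, Jy⟩ = ⟨x,y⟩ for all x,y; J is parallel for the Levi-Civita connection ∇ of ⟨·,·⟩, i.e. ∇_x(Jy) = J(∇_x y) for all x,y; and the metric is Ricci-flat (ρ = 0) but not flat (R ≠ 0). -/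

import Mathlib

open Matrix

noncomputable section

/-- The Lie bracket of `T*𝔥₃` in the basis `(e₁,…,e₆)`:
`[e₁,e₂]=e₆`, `[e₁,e₃]=−e₅`, `[e₂,e₃]=e₄`. -/
def bra (x y : Fin 6 → ℝ) : Fin 6 → ℝ :=
  ![0, 0, 0, x 1 * y 2 - x 2 * y 1, x 2 * y 0 - x 0 * y 2, x 0 * y 1 - x 1 * y 0]

/-- The complex structure `J` with `Je₁ = e₂`, `Je₃ = −e₆`, `Je₄ = e₅`
(columns are the images of the basis vectors). -/
def Jc : Matrix (Fin 6) (Fin 6) ℝ :=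
  !![0, -1, 0, 0, 0, 0;
     1,  0, 0, 0, 0, 0;
     0,  0, 0, 0, 0, 1;
     0,  0, 0, 0, -1, 0;
     0,  0, 0, 1, 0, 0;
     0,  0, -1, 0, 0, 0]

/-- The matrix of the symplectic form
`Ω = a₁₂ e¹∧e² + a₁₃(e¹∧e³ − e²∧e⁶) + a₁₄(e¹∧e⁴ + e²∧e⁵ − 2e³∧e⁶)
  + a₁₅(e¹∧e⁵ − e²∧e⁴) + a₁₆(e¹∧e⁶ + e²∧e³)`,
so that `Ω(x,y) = x ⬝ᵥ (Om.mulVec y)`. -/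
def Om (a12 a13 a14 a15 a16 : ℝ) : Matrix (Fin 6) (Fin 6) ℝ :=
  !![0, a12, a13, a14, a15, a16;
     -a12, 0, a16, -a15, a14, -a13;
     -a13, -a16, 0, 0, 0, -2 * a14;
     -a14, a15, 0, 0, 0, 0;
     -a15, -a14, 0, 0, 0, 0;
     -a16, a13, 2 * a14, 0, 0, 0]

/-- Curvature `R(x,y)z = ∇ₓ∇_y z − ∇_y∇ₓ z − ∇_{[x,y]} z` of a connection `D`. -/
def curv (D : (Fin 6 → ℝ) → (Fin 6 → ℝ) → (Fin 6 → ℝ)) (x y z : Fin 6 → ℝ) :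
    Fin 6 → ℝ :=
  D x (D y z) - D y (D x z) - D (bra x y) z

/-- Ricci tensor `ρ(x,y) = tr(z ↦ R(z,x)y)`, computed in the standard basis. -/
def ricci (D : (Fin 6 → ℝ) → (Fin 6 → ℝ) → (Fin 6 → ℝ)) (x y : Fin 6 → ℝ) : ℝ :=
  ∑ i : Fin 6, curv D (Pi.single i 1) x y i

def PP (p q a b c : ℝ) (x y : Fin 6 → ℝ) : ℝ :=
  -a * x 0 * y 2 + b * x 2 * y 1 - q * x 0 * y 1 - c * x 1 * y 1 - a * (x 5 * y 1 + x 1 * y 5)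
    + q * (x 0 * y 1 - x 1 * y 0) / 2 + c * (x 0 * y 0 + x 1 * y 1) / 2

def QQ (p q a b c : ℝ) (x y : Fin 6 → ℝ) : ℝ :=
  -b * x 2 * y 0 - a * x 1 * y 2 + q * x 0 * y 0 + c * x 1 * y 0 + a * (x 5 * y 0 + x 0 * y 5)
    + c * (x 0 * y 1 - x 1 * y 0) / 2 - q * (x 0 * y 0 + x 1 * y 1) / 2

def DD (p q a b c : ℝ) (x y : Fin 6 → ℝ) : Fin 6 → ℝ :=
  ![0, 0, -(x 0 * y 0 + x 1 * y 1) / 2,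
    -(b * PP p q a b c x y + a * QQ p q a b c x y) / (a ^ 2 + b ^ 2),
    (a * PP p q a b c x y - b * QQ p q a b c x y) / (a ^ 2 + b ^ 2),
    (x 0 * y 1 - x 1 * y 0) / 2]

theorem Jv (x : Fin 6 → ℝ) : Jc.mulVec x = ![-x 1, x 0, x 5, -x 4, x 3, -x 2] := by
  ext i
  fin_cases i <;> simp [Jc, Matrix.mulVec, dotProduct, Fin.sum_univ_succ] <;> rfl

theorem gv (p q a b c : ℝ) (x y : Fin 6 → ℝ) :
    (Jc.mulVec x) ⬝ᵥ ((Om p q a b c).mulVec y) =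
      (-p * x 0 - q * x 5 + a * x 4 - b * x 3 + c * x 2) * y 0
      + (-p * x 1 - c * x 5 - b * x 4 - a * x 3 - q * x 2) * y 1
      + (-q * x 1 + c * x 0 - 2 * a * x 2) * y 2
      + (-a * x 1 - b * x 0) * y 3 + (-b * x 1 + a * x 0) * y 4
      + (-c * x 1 - q * x 0 - 2 * a * x 5) * y 5 := by
  rw [Jv]
  have e2 : (Fin.succ 1 : Fin 5) = 2 := rfl
  simp [Om, Matrix.mulVec, dotProduct, Fin.sum_univ_six]
  ring

theorem nondeg (p q a b c : ℝ) (ha : a ≠ 0) (x : Fin 6 → ℝ)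
    (h : ∀ y, (Jc.mulVec x) ⬝ᵥ ((Om p q a b c).mulVec y) = 0) : x = 0 := by
  have hs : a ^ 2 + b ^ 2 ≠ 0 := by positivity
  simp only [gv] at h
  have h0 := h (Pi.single 0 1)
  have h1 := h (Pi.single 1 1)
  have h2 := h (Pi.single 2 1)
  have h3 := h (Pi.single 3 1)
  have h4 := h (Pi.single 4 1)
  have h5 := h (Pi.single 5 1)
  simp [Pi.single_apply] at h0 h1 h2 h3 h4 h5
  have x0 : x 0 = 0 := by
    apply (mul_eq_zero.1 (_ : (a ^ 2 + b ^ 2) * x 0 = 0)).resolve_left hs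
    linear_combination a * h4 - b * h3
  have x1 : x 1 = 0 := by
    apply (mul_eq_zero.1 (_ : (a ^ 2 + b ^ 2) * x 1 = 0)).resolve_left hs
    linear_combination -b * h4 - a * h3
  have x2 : x 2 = 0 := by
    apply (mul_eq_zero.1 (_ : a * x 2 = 0)).resolve_left ha
    linear_combination (-1 / 2) * h2 - q / 2 * x1 + c / 2 * x0
  have x5 : x 5 = 0 := by
    apply (mul_eq_zero.1 (_ : a * x 5 = 0)).resolve_left ha
    linear_combination (-1 / 2) * h5 - c / 2 * x1 - q / 2 * x0
  rw [x0, x2, x5] at h0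
  rw [x1, x2, x5] at h1
  have x4 : x 4 = 0 := by
    apply (mul_eq_zero.1 (_ : (a ^ 2 + b ^ 2) * x 4 = 0)).resolve_left hs
    linear_combination a * h0 - b * h1
  have x3 : x 3 = 0 := by
    apply (mul_eq_zero.1 (_ : (a ^ 2 + b ^ 2) * x 3 = 0)).resolve_left hs
    linear_combination -b * h0 - a * h1
  ext i
  fin_cases i <;> simpa

theorem DD_koszul (p q a b c : ℝ) (ha : a ≠ 0) (x y z : Fin 6 → ℝ) :
    2 * (Jc.mulVec (DD p q a b c x y)) ⬝ᵥ ((Om p q a b c).mulVec z) =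
      (Jc.mulVec (bra x y)) ⬝ᵥ ((Om p q a b c).mulVec z)
      - (Jc.mulVec (bra y z)) ⬝ᵥ ((Om p q a b c).mulVec x)
      + (Jc.mulVec (bra z x)) ⬝ᵥ ((Om p q a b c).mulVec y) := by
  have hs : a ^ 2 + b ^ 2 ≠ 0 := by positivity
  simp only [gv]
  simp [DD, bra, PP, QQ]
  field_simp
  ring

/-- The pseudo-Kähler metric `⟨x,y⟩ = Ω(Jx,y)` on `T*𝔥₃`: it is a nondegenerate
symmetric bilinear form, `J` is an integrable Hermitian complex structure which is
parallel for the Levi-Civita connection, and the metric is Ricci-flat but not flat. -/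
theorem stmt_19 (a12 a13 a14 a15 a16 : ℝ) (ha : a14 ≠ 0)
    (g : (Fin 6 → ℝ) → (Fin 6 → ℝ) → ℝ)
    (hg : ∀ x y, g x y = (Jc.mulVec x) ⬝ᵥ ((Om a12 a13 a14 a15 a16).mulVec y))
    (D : (Fin 6 → ℝ) → (Fin 6 → ℝ) → (Fin 6 → ℝ))
    (hkoszul : ∀ x y z, 2 * g (D x y) z =
      g (bra x y) z - g (bra y z) x + g (bra z x) y) :
    (∀ x y, g x y = g y x) ∧
    (∀ x, (∀ y, g x y = 0) → x = 0) ∧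
    Jc * Jc = -1 ∧
    (∀ x y, bra x y - bra (Jc.mulVec x) (Jc.mulVec y)
      + Jc.mulVec (bra (Jc.mulVec x) y) + Jc.mulVec (bra x (Jc.mulVec y)) = 0) ∧
    (∀ x y, g (Jc.mulVec x) (Jc.mulVec y) = g x y) ∧
    (∀ x y, D x (Jc.mulVec y) = Jc.mulVec (D x y)) ∧
    (∀ x y, ricci D x y = 0) ∧
    (∃ x y z, curv D x y z ≠ 0) := by
  have hD : D = DD a12 a13 a14 a15 a16 := by
    funext x y
    rw [← sub_eq_zero]
    apply nondeg a12 a13 a14 a15 a16 ha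
    intro z
    have h1 := hkoszul x y z
    have h2 := DD_koszul a12 a13 a14 a15 a16 ha x y z
    simp only [hg] at h1
    rw [Matrix.mulVec_sub, sub_dotProduct]
    linarith
  have hs : a14 ^ 2 + a15 ^ 2 ≠ 0 := by positivity
  subst hD
  clear hkoszul
  refine ⟨?_, ?_, ?_, ?_, ?_, ?_, ?_, ?_⟩
  · intro x y
    simp only [hg, gv]
    ring
  · intro x h
    exact nondeg a12 a13 a14 a15 a16 ha x (fun y => by rw [← hg, h])
  · ext i j
    fin_cases i <;> fin_cases j <;> simp [Jc, Matrix.mul_apply, Fin.sum_univ_six]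
  · intro x y
    simp only [Jv]
    ext i
    fin_cases i <;> simp [bra] <;> ring
  · intro x y
    simp only [hg, gv]
    simp [Jv]
    ring
  · intro x y
    simp only [Jv]
    ext i
    fin_cases i <;> simp [DD, PP, QQ] <;> field_simp <;> ring
  · intro x y
    simp only [ricci, curv, Fin.sum_univ_six]
    simp [DD, PP, QQ, bra, Pi.single_apply]
    try field_simp
    try ring
  · refine ⟨Pi.single 0 1, Pi.single 1 1, Pi.single 0 1, fun h => ?_⟩
    have h3 := congrFun h 3
    simp [curv, DD, PP, QQ, bra, Pi.single_apply] at h3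
    field_simp at h3
    ring_nf at h3
    simp at h3
    exact ha h3
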